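/- arXiv:2105.08977 — 3 statements merged into one kernel-verified Lean document; each statement's English description precedes it below -/
import Mathlib

section
/- Fix 0 < H < 1 and ε ∈ (0, H). There exists a constant C = C(H,ε) > 0 such that for all η ∈ ℝ and all 0 ≤ s ≤ t ≤ 1: ∫_ℝ |γ_{s,t}(ξ,|η|)|² / |ξ|^{2H−1} dξ ≤ C · |t−s|^ε / (1 + |η|^{4(H−ε)}). -/
open MeasureTheory

/-- `γ_t(ξ, r) = e^{iξt} ∫_0^t e^{-u(r² + iξ)} du`. -/
noncomputable def gam (t ξ r : ℝ) : ℂ :=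
  Complex.exp (Complex.I * (ξ * t)) *
    ∫ u in (0:ℝ)..t, Complex.exp (-(u : ℂ) * ((r : ℂ) ^ 2 + Complex.I * (ξ : ℂ)))

/-- `γ_{s,t}(ξ, r) = γ_t(ξ, r) - γ_s(ξ, r)`. -/
noncomputable def gamst (s t ξ r : ℝ) : ℂ := gam t ξ r - gam s ξ r

theorem gam_mul (t ξ r : ℝ) (hξ : ξ ≠ 0) :
    gam t ξ r * ((r : ℂ) ^ 2 + Complex.I * ξ) =
      Complex.exp (Complex.I * (ξ * t : ℝ)) - (Real.exp (-(r ^ 2 * t)) : ℝ) := by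
  have hz : ((r : ℂ) ^ 2 + Complex.I * ξ) ≠ 0 := by
    intro h
    have := congrArg Complex.im h
    simp [← Complex.ofReal_pow] at this
    exact hξ this
  have hint : (∫ u in (0:ℝ)..t, Complex.exp (-(u : ℂ) * ((r : ℂ) ^ 2 + Complex.I * ξ))) =
      (1 - Complex.exp (-t * ((r : ℂ) ^ 2 + Complex.I * ξ))) / ((r : ℂ) ^ 2 + Complex.I * ξ) := by
    have h := integral_exp_mul_complex (a := 0) (b := t) (neg_ne_zero.mpr hz)
    have e : ∀ u : ℝ, -(u : ℂ) * ((r : ℂ) ^ 2 + Complex.I * ξ) =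
        -((r : ℂ) ^ 2 + Complex.I * ξ) * u := fun u => by ring
    simp only [e]
    rw [h, Complex.ofReal_zero, mul_zero, Complex.exp_zero, div_neg, ← neg_div, neg_sub]
  rw [gam, hint, mul_assoc, div_mul_cancel₀ _ hz, mul_sub, mul_one, ← Complex.exp_add]
  push_cast
  congr 2
  ring

theorem norm_exp_I_mul_sub_le (x y : ℝ) :
    ‖Complex.exp (Complex.I * x) - Complex.exp (Complex.I * y)‖ ≤ |x - y| := by
  have h : Complex.exp (Complex.I * x) - Complex.exp (Complex.I * y) =
      Complex.exp (Complex.I * y) * (Complex.exp (Complex.I * (x - y : ℝ)) - 1) := by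
    rw [mul_sub, mul_one, ← Complex.exp_add]
    push_cast
    ring_nf
  rw [h, norm_mul, Complex.norm_exp_I_mul_ofReal, one_mul]
  exact Real.norm_exp_I_mul_ofReal_sub_one_le

theorem abs_exp_neg_sub_le {x y : ℝ} (hy : 0 ≤ y) (hyx : y ≤ x) :
    |Real.exp (-x) - Real.exp (-y)| ≤ x - y := by
  have h1 : Real.exp (-x) ≤ Real.exp (-y) := Real.exp_le_exp.mpr (by linarith)
  have h2 : Real.exp (-x) = Real.exp (-y) * Real.exp (-(x - y)) := by
    rw [← Real.exp_add]; ring_nf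
  have h3 : -(x - y) + 1 ≤ Real.exp (-(x - y)) := Real.add_one_le_exp _
  have h4 : Real.exp (-y) ≤ 1 := Real.exp_le_one_iff.mpr (by linarith)
  have h5 : 0 < Real.exp (-y) := Real.exp_pos _
  rw [abs_sub_comm, abs_of_nonneg (by linarith), h2]
  nlinarith

theorem norm_gamst_sq_le {s t ξ r : ℝ} (hξ : ξ ≠ 0) (hs : 0 ≤ s) (hst : s ≤ t) (ht : t ≤ 1) :
    ‖gamst s t ξ r‖ ^ 2 ≤ 2 * (t - s) ^ 2 ∧
      (1 + (r ^ 2) ^ 2 + ξ ^ 2) * ‖gamst s t ξ r‖ ^ 2 ≤ 18 := by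
  have hpos : 0 < (r ^ 2) ^ 2 + ξ ^ 2 := by positivity
  have hnorm : ‖((r : ℂ) ^ 2 + Complex.I * ξ)‖ ^ 2 = (r ^ 2) ^ 2 + ξ ^ 2 := by
    rw [mul_comm, ← Complex.ofReal_pow, ← Complex.normSq_eq_norm_sq, Complex.normSq_add_mul_I]
  have hmul : gamst s t ξ r * ((r : ℂ) ^ 2 + Complex.I * ξ) =
      (Complex.exp (Complex.I * (ξ * t : ℝ)) - Complex.exp (Complex.I * (ξ * s : ℝ))) -
        ((Real.exp (-(r ^ 2 * t)) - Real.exp (-(r ^ 2 * s)) : ℝ) : ℂ) := by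
    rw [gamst, sub_mul, gam_mul t ξ r hξ, gam_mul s ξ r hξ]
    push_cast
    ring
  have hsq : ‖gamst s t ξ r‖ ^ 2 * ((r ^ 2) ^ 2 + ξ ^ 2) =
      ‖gamst s t ξ r * ((r : ℂ) ^ 2 + Complex.I * ξ)‖ ^ 2 := by
    rw [norm_mul, mul_pow, hnorm]
  have hr : 0 ≤ r ^ 2 := sq_nonneg r
  have hlip : ‖gamst s t ξ r * ((r : ℂ) ^ 2 + Complex.I * ξ)‖ ≤ (t - s) * (|ξ| + r ^ 2) := by
    rw [hmul]
    refine (norm_sub_le _ _).trans ?_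
    have h1 := norm_exp_I_mul_sub_le (ξ * t) (ξ * s)
    rw [← mul_sub, abs_mul, abs_of_nonneg (sub_nonneg.mpr hst)] at h1
    have h2 := abs_exp_neg_sub_le (mul_nonneg hr hs) (mul_le_mul_of_nonneg_left hst hr)
    rw [Complex.norm_real, Real.norm_eq_abs]
    linarith
  have hbdd : ‖gamst s t ξ r * ((r : ℂ) ^ 2 + Complex.I * ξ)‖ ≤ 4 := by
    rw [hmul]
    refine (norm_sub_le _ _).trans ?_
    have h1 := norm_sub_le (Complex.exp (Complex.I * (ξ * t : ℝ)))
      (Complex.exp (Complex.I * (ξ * s : ℝ)))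
    rw [Complex.norm_exp_I_mul_ofReal, Complex.norm_exp_I_mul_ofReal] at h1
    have h2 : Real.exp (-(r ^ 2 * t)) ≤ 1 :=
      Real.exp_le_one_iff.mpr (by nlinarith [mul_nonneg hr (hs.trans hst)])
    have h3 : Real.exp (-(r ^ 2 * s)) ≤ 1 :=
      Real.exp_le_one_iff.mpr (by nlinarith [mul_nonneg hr hs])
    have h4 : |Real.exp (-(r ^ 2 * t)) - Real.exp (-(r ^ 2 * s))| ≤ 1 := by
      rw [abs_le]
      constructor <;> linarith [Real.exp_pos (-(r ^ 2 * t)), Real.exp_pos (-(r ^ 2 * s))]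
    rw [Complex.norm_real, Real.norm_eq_abs]
    linarith
  have hfirst : ‖gamst s t ξ r‖ ^ 2 ≤ 2 * (t - s) ^ 2 := by
    refine le_of_mul_le_mul_right ?_ hpos
    rw [hsq]
    refine (pow_le_pow_left₀ (norm_nonneg _) hlip 2).trans ?_
    rw [mul_pow, mul_comm 2, mul_assoc, ← sq_abs ξ]
    refine mul_le_mul_of_nonneg_left ?_ (sq_nonneg _)
    nlinarith [sq_nonneg (|ξ| - r ^ 2)]
  refine ⟨hfirst, ?_⟩
  have h16 := pow_le_pow_left₀ (norm_nonneg _) hbdd 2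
  rw [← hsq] at h16
  have h1 : (t - s) ^ 2 ≤ 1 := pow_le_one₀ (by linarith) (by linarith)
  linarith

theorem integrable_one_add_sq_rpow_mul_abs_rpow {p q : ℝ} (hp : p ≤ 0) (hq : -1 < q)
    (hpq : 2 * p + q < -1) :
    Integrable fun x : ℝ => (1 + x ^ 2) ^ p * |x| ^ q := by
  have hmeas : Measurable fun x : ℝ => (1 + x ^ 2) ^ p * |x| ^ q := by fun_prop
  have hIoc : IntegrableOn (fun x : ℝ => (1 + x ^ 2) ^ p * |x| ^ q) (Set.Ioc 0 1) := by
    have h := (intervalIntegrable_iff_integrableOn_Ioc_of_le zero_le_one).mp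
      (intervalIntegral.intervalIntegrable_rpow' (a := 0) (b := 1) hq)
    refine Integrable.mono' h hmeas.aestronglyMeasurable ?_
    filter_upwards [ae_restrict_mem measurableSet_Ioc] with x hx
    rw [Real.norm_of_nonneg (by positivity), abs_of_pos hx.1]
    exact mul_le_of_le_one_left (Real.rpow_nonneg hx.1.le _)
      (Real.rpow_le_one_of_one_le_of_nonpos (by nlinarith [sq_nonneg x]) hp)
  have hIoi : IntegrableOn (fun x : ℝ => (1 + x ^ 2) ^ p * |x| ^ q) (Set.Ioi 1) := by
    refine Integrable.mono' (integrableOn_Ioi_rpow_of_lt hpq zero_lt_one)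
      hmeas.aestronglyMeasurable ?_
    filter_upwards [ae_restrict_mem measurableSet_Ioi] with x hx
    have hx0 : 0 < x := zero_lt_one.trans hx
    rw [Real.norm_of_nonneg (by positivity), abs_of_pos hx0, Real.rpow_add hx0,
      Real.rpow_mul hx0.le, Real.rpow_two]
    exact mul_le_mul_of_nonneg_right
      (Real.rpow_le_rpow_of_nonpos (by positivity) (by linarith) hp) (Real.rpow_nonneg hx0.le _)
  have hpos : IntegrableOn (fun x : ℝ => (1 + x ^ 2) ^ p * |x| ^ q) (Set.Ioi 0) := by
    rw [← Set.Ioc_union_Ioi_eq_Ioi zero_le_one]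
    exact hIoc.union hIoi
  have hneg : IntegrableOn (fun x : ℝ => (1 + x ^ 2) ^ p * |x| ^ q) (Set.Iic 0) := by
    rw [← Measure.map_neg_eq_self (volume : Measure ℝ)]
    have m : MeasurableEmbedding fun x : ℝ => -x := (Homeomorph.neg ℝ).measurableEmbedding
    rw [m.integrableOn_map_iff]
    simp_rw [Function.comp_def, abs_neg, neg_sq, Set.neg_preimage, Set.neg_Iic, neg_zero]
    exact Iff.mpr integrableOn_Ici_iff_integrableOn_Ioi hpos
  rw [← integrableOn_univ, ← Set.Iic_union_Ioi (a := (0 : ℝ))]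
  exact hneg.union hpos

theorem sq_add_sq_rpow_mul_abs_rpow_eq {b : ℝ} (hb : 0 < b) (p q x : ℝ) :
    (b ^ 2 + x ^ 2) ^ p * |x| ^ q =
      b ^ (2 * p + q) * ((1 + (x / b) ^ 2) ^ p * |x / b| ^ q) := by
  have h1 : b ^ 2 + x ^ 2 = b ^ 2 * (1 + (x / b) ^ 2) := by field_simp
  have h2 : |x| = b * |x / b| := by rw [abs_div, abs_of_pos hb]; field_simp
  rw [h1, h2, Real.mul_rpow (by positivity) (by positivity), Real.mul_rpow hb.le (by positivity),
    Real.rpow_add hb, Real.rpow_mul hb.le, Real.rpow_two]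
  ring

theorem integrable_sq_add_sq_rpow_mul_abs_rpow {b p q : ℝ} (hb : 0 < b) (hp : p ≤ 0) (hq : -1 < q)
    (hpq : 2 * p + q < -1) :
    Integrable fun x : ℝ => (b ^ 2 + x ^ 2) ^ p * |x| ^ q := by
  simp_rw [sq_add_sq_rpow_mul_abs_rpow_eq hb]
  exact ((integrable_one_add_sq_rpow_mul_abs_rpow hp hq hpq).comp_div hb.ne').const_mul _

theorem integral_sq_add_sq_rpow_mul_abs_rpow {b : ℝ} (hb : 0 < b) (p q : ℝ) :
    ∫ x : ℝ, (b ^ 2 + x ^ 2) ^ p * |x| ^ q =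
      b ^ (2 * p + q + 1) * ∫ x : ℝ, (1 + x ^ 2) ^ p * |x| ^ q := by
  simp_rw [sq_add_sq_rpow_mul_abs_rpow_eq hb]
  rw [integral_const_mul,
    Measure.integral_comp_div (fun x : ℝ => (1 + x ^ 2) ^ p * |x| ^ q) b, abs_of_pos hb,
    smul_eq_mul, Real.rpow_add_one hb.ne', mul_assoc]

theorem le_rpow_mul_rpow_of_le {x d A M ε : ℝ} (hx : 0 ≤ x) (hd : 0 ≤ d) (hA : 0 < A)
    (hM : 2 ≤ M) (hε0 : 0 ≤ ε) (hε1 : ε ≤ 1) (h1 : x ≤ 2 * d ^ 2) (h2 : A * x ≤ M) :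
    x ≤ M * d ^ (2 * ε) * A ^ (ε - 1) := by
  have hM0 : 0 ≤ M := by linarith
  calc x = x ^ ε * x ^ (1 - ε) := by
        rw [← Real.rpow_add_of_nonneg hx hε0 (by linarith), add_sub_cancel, Real.rpow_one]
    _ ≤ (M * d ^ 2) ^ ε * (M * A⁻¹) ^ (1 - ε) := by
        have h3 : x ≤ M * d ^ 2 := h1.trans (mul_le_mul_of_nonneg_right hM (sq_nonneg d))
        have h4 : x ≤ M * A⁻¹ := by
          rw [← div_eq_mul_inv, le_div_iff₀ hA]; linarith
        have h5 : 0 ≤ 1 - ε := by linarith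
        gcongr
    _ = M * d ^ (2 * ε) * A ^ (ε - 1) := by
        rw [Real.mul_rpow hM0 (sq_nonneg d), Real.mul_rpow hM0 (by positivity),
          Real.inv_rpow hA.le, ← Real.rpow_neg hA.le, neg_sub, Real.rpow_mul hd, Real.rpow_two]
        have : M ^ ε * M ^ (1 - ε) = M := by
          rw [← Real.rpow_add_of_nonneg hM0 hε0 (by linarith), add_sub_cancel, Real.rpow_one]
        linear_combination (d ^ 2) ^ ε * A ^ (ε - 1) * this

/-- Fix `0 < H < 1` and `ε ∈ (0, H)`.  There is a constant `C = C(H, ε) > 0` such that for all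
`η ∈ ℝ` and all `0 ≤ s ≤ t ≤ 1`:
`∫_ℝ |γ_{s,t}(ξ,|η|)|² / |ξ|^{2H−1} dξ ≤ C · |t−s|^ε / (1 + |η|^{4(H−ε)})`. -/
theorem stmt5 (H ε : ℝ) (hH0 : 0 < H) (hH1 : H < 1) (hε0 : 0 < ε) (hεH : ε < H) :
    ∃ C : ℝ, 0 < C ∧ ∀ η s t : ℝ, 0 ≤ s → s ≤ t → t ≤ 1 →
      (∫ ξ : ℝ, ‖gamst s t ξ |η|‖ ^ 2 / |ξ| ^ (2 * H - 1)) ≤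
        C * |t - s| ^ ε / (1 + |η| ^ (4 * (H - ε))) := by
  set K : ℝ := ∫ x : ℝ, (1 + x ^ 2) ^ (ε - 1) * |x| ^ (1 - 2 * H) with hK
  have hK0 : 0 ≤ K := integral_nonneg fun x => by positivity
  refine ⟨36 * K + 1, by positivity, fun η s t hs hst ht => ?_⟩
  have hd0 : 0 ≤ t - s := sub_nonneg.mpr hst
  have hd1 : t - s ≤ 1 := by linarith
  set b : ℝ := √(1 + (|η| ^ 2) ^ 2) with hb
  have hb2 : b ^ 2 = 1 + (|η| ^ 2) ^ 2 := Real.sq_sqrt (by positivity)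
  have hb1 : 1 ≤ b := Real.one_le_sqrt.mpr (by linarith [sq_nonneg (|η| ^ 2)])
  have hbη : |η| ^ 2 ≤ b := Real.le_sqrt_of_sq_le (by linarith)
  have hb0 : 0 < b := by linarith
  have hle : (∫ ξ : ℝ, ‖gamst s t ξ |η|‖ ^ 2 / |ξ| ^ (2 * H - 1)) ≤
      ∫ ξ : ℝ, 18 * (t - s) ^ (2 * ε) * ((b ^ 2 + ξ ^ 2) ^ (ε - 1) * |ξ| ^ (1 - 2 * H)) := by
    refine integral_mono_of_nonneg (Filter.Eventually.of_forall fun ξ => by positivity)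
      ((integrable_sq_add_sq_rpow_mul_abs_rpow hb0 (by linarith) (by linarith)
        (by linarith)).const_mul _) ?_
    filter_upwards [Measure.ae_ne volume (0 : ℝ)] with ξ hξ
    obtain ⟨h1, h2⟩ := norm_gamst_sq_le (r := |η|) hξ hs hst ht
    rw [← hb2] at h2
    have h3 := le_rpow_mul_rpow_of_le (sq_nonneg _) hd0 (by positivity) (by norm_num) hε0.le
      (by linarith) h1 h2
    rw [div_eq_mul_inv, ← Real.rpow_neg (abs_nonneg ξ), neg_sub, ← mul_assoc]
    exact mul_le_mul_of_nonneg_right h3 (by positivity)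
  rw [integral_const_mul, integral_sq_add_sq_rpow_mul_abs_rpow hb0, ← hK] at hle
  refine hle.trans ?_
  have hexp : 2 * (ε - 1) + (1 - 2 * H) + 1 = -(2 * (H - ε)) := by ring
  have hden : 1 + |η| ^ (4 * (H - ε)) ≤ 2 * b ^ (2 * (H - ε)) := by
    have h1 : 1 ≤ b ^ (2 * (H - ε)) := Real.one_le_rpow hb1 (by linarith)
    have h2 : |η| ^ (4 * (H - ε)) ≤ b ^ (2 * (H - ε)) := by
      have h3 : 4 * (H - ε) = 2 * (2 * (H - ε)) := by ring
      rw [h3, Real.rpow_mul (abs_nonneg η), Real.rpow_two]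
      exact Real.rpow_le_rpow (by positivity) hbη (by linarith)
    linarith
  have hdd : (t - s) ^ (2 * ε) ≤ (t - s) ^ ε :=
    Real.rpow_le_rpow_of_exponent_ge_of_imp hd0 hd1 (by linarith) (fun _ h => by linarith)
  have hB : 0 < b ^ (2 * (H - ε)) := by positivity
  have hD : 0 ≤ (t - s) ^ ε := Real.rpow_nonneg hd0 _
  rw [hexp, Real.rpow_neg hb0.le, abs_of_nonneg hd0, le_div_iff₀ (by positivity)]
  calc 18 * (t - s) ^ (2 * ε) * ((b ^ (2 * (H - ε)))⁻¹ * K) * (1 + |η| ^ (4 * (H - ε)))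
      ≤ 18 * (t - s) ^ ε * ((b ^ (2 * (H - ε)))⁻¹ * K) * (2 * b ^ (2 * (H - ε))) := by gcongr
    _ = 36 * K * (t - s) ^ ε := by field_simp; ring
    _ ≤ (36 * K + 1) * (t - s) ^ ε := by linarith
end

section
/- Let χ : ℝ → ℝ be a smooth compactly supported function with Fourier transform χ̂(λ) := ∫_ℝ χ(y) e^{−iλy} dy, let σ ∈ ℝ and p ≥ 1 an integer. For η ∈ ℝ define F_η : ℝ → ℂ by F_η(x) := ∫_ℝ (1+λ²)^{−σ/2} e^{ixλ} χ̂(λ−η) dλ. Then there exists a constant C > 0, depending only on χ, σ and p, such that for all η₁, …, η_p ∈ ℝ: ∫_ℝ ∏_{i=1}^p |F_{η_i}(x)|² dx ≤ C · ∏_{i=1}^p (1+η_i²)^{−σ}. -/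
open MeasureTheory

/-- The Fourier transform `χ̂(λ) = ∫_ℝ χ(y) e^{-iλy} dy`. -/
noncomputable def fourierT (χ : ℝ → ℝ) (l : ℝ) : ℂ :=
  ∫ y : ℝ, (χ y : ℂ) * Complex.exp (-(Complex.I * (l * y)))

/-- For `η ∈ ℝ`, `F_η(x) = ∫_ℝ (1+λ²)^{−σ/2} e^{ixλ} χ̂(λ−η) dλ`. -/
noncomputable def besselF (χ : ℝ → ℝ) (σ η x : ℝ) : ℂ :=
  ∫ l : ℝ, (((1 + l ^ 2) ^ (-(σ / 2)) : ℝ) : ℂ) *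
    Complex.exp (Complex.I * (x * l)) * fourierT χ (l - η)

open scoped FourierTransform SchwartzMap

lemma one_add_sq_le_two_mul (a b : ℝ) : 1 + a ^ 2 ≤ 2 * (1 + b ^ 2) * (1 + (a - b) ^ 2) := by
  nlinarith [sq_nonneg (a - 2 * b), sq_nonneg (b * (a - b))]

/-- Peetre's inequality. -/
lemma one_add_sq_rpow_le (s a b : ℝ) :
    (1 + a ^ 2) ^ s ≤ 2 ^ |s| * (1 + b ^ 2) ^ s * (1 + (a - b) ^ 2) ^ |s| := by
  have ha : 0 < 1 + a ^ 2 := by positivity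
  have hb : 0 < 1 + b ^ 2 := by positivity
  have hc : 0 < 1 + (a - b) ^ 2 := by positivity
  rcases le_total 0 s with hs | hs
  · rw [abs_of_nonneg hs, ← Real.mul_rpow (by positivity) (by positivity),
      ← Real.mul_rpow (by positivity) (by positivity)]
    exact Real.rpow_le_rpow ha.le (one_add_sq_le_two_mul a b) hs
  · have h := Real.rpow_le_rpow hb.le (one_add_sq_le_two_mul b a) (neg_nonneg.2 hs)
    rw [Real.mul_rpow (by positivity) (by positivity),
      Real.mul_rpow (by positivity) (by positivity), show (b - a) ^ 2 = (a - b) ^ 2 by ring,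
      Real.rpow_neg hb.le, Real.rpow_neg ha.le] at h
    rw [abs_of_nonpos hs]
    have h1 : 0 < (1 + a ^ 2) ^ s := Real.rpow_pos_of_pos ha s
    have h2 : 0 < (1 + b ^ 2) ^ s := Real.rpow_pos_of_pos hb s
    have h3 := mul_le_mul_of_nonneg_left h (mul_pos h1 h2).le
    calc (1 + a ^ 2) ^ s = (1 + a ^ 2) ^ s * (1 + b ^ 2) ^ s * ((1 + b ^ 2) ^ s)⁻¹ := by
          field_simp
      _ ≤ _ := h3
      _ = _ := by field_simp

lemma hasDerivAt_one_add_sq_rpow (s l : ℝ) :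
    HasDerivAt (fun l : ℝ => (1 + l ^ 2) ^ s) (2 * l * s * (1 + l ^ 2) ^ (s - 1)) l := by
  have h : HasDerivAt (fun l : ℝ => 1 + l ^ 2) (2 * l) l := by
    simpa using (hasDerivAt_pow 2 l).const_add 1
  exact h.rpow_const (Or.inl (by positivity))

lemma abs_deriv_one_add_sq_rpow_le (s l : ℝ) :
    |2 * l * s * (1 + l ^ 2) ^ (s - 1)| ≤ |s| * (1 + l ^ 2) ^ s := by
  have hl : 0 < 1 + l ^ 2 := by positivity
  have h2 : |2 * l| ≤ 1 + l ^ 2 := abs_le.2 ⟨by nlinarith [sq_nonneg (l + 1)],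
    by nlinarith [sq_nonneg (l - 1)]⟩
  rw [abs_mul, abs_mul, abs_of_pos (Real.rpow_pos_of_pos hl _), Real.rpow_sub_one hl.ne']
  have h1 : 0 < (1 + l ^ 2) ^ s := Real.rpow_pos_of_pos hl s
  calc |2 * l| * |s| * ((1 + l ^ 2) ^ s / (1 + l ^ 2))
      ≤ (1 + l ^ 2) * |s| * ((1 + l ^ 2) ^ s / (1 + l ^ 2)) := by gcongr
    _ = _ := by field_simp

lemma SchwartzMap.exists_one_add_sq_rpow_mul_norm_le (g : 𝓢(ℝ, ℂ)) (r : ℝ) :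
    ∃ K : ℝ, 0 ≤ K ∧ ∀ u : ℝ, (1 + u ^ 2) ^ r * ‖g u‖ ≤ K := by
  obtain ⟨N, hN⟩ := exists_nat_ge r
  refine ⟨2 ^ (2 * N) * ((Finset.Iic (2 * N, 0)).sup
    (fun m => SchwartzMap.seminorm ℝ m.1 m.2)) g, by positivity, fun u => ?_⟩
  have h := SchwartzMap.one_add_le_sup_seminorm_apply (𝕜 := ℝ) (m := (2 * N, 0)) (k := 2 * N)
    (n := 0) le_rfl le_rfl g u
  rw [norm_iteratedFDeriv_zero] at h
  refine le_trans ?_ h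
  gcongr
  calc (1 + u ^ 2) ^ r ≤ (1 + u ^ 2) ^ (N : ℝ) :=
        Real.rpow_le_rpow_of_exponent_le (by nlinarith [sq_nonneg u]) hN
    _ = (1 + u ^ 2) ^ N := Real.rpow_natCast _ _
    _ ≤ ((1 + ‖u‖) ^ 2) ^ N := by
        gcongr
        rw [Real.norm_eq_abs]
        nlinarith [sq_abs u, abs_nonneg u]
    _ = _ := by rw [← pow_mul]

lemma SchwartzMap.exists_weight_mul_norm_sub_le (g : 𝓢(ℝ, ℂ)) (s : ℝ) :
    ∃ M : ℝ, 0 ≤ M ∧ ∀ η l : ℝ, (1 + l ^ 2) ^ s * ‖g (l - η)‖ ≤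
      M * (1 + η ^ 2) ^ s * (1 + (l - η) ^ 2)⁻¹ := by
  obtain ⟨K, hK, h⟩ := g.exists_one_add_sq_rpow_mul_norm_le (|s| + 1)
  refine ⟨2 ^ |s| * K, by positivity, fun η l => ?_⟩
  have hu : 0 < 1 + (l - η) ^ 2 := by positivity
  have h1 := h (l - η)
  rw [Real.rpow_add_one hu.ne'] at h1
  have h2 : (1 + (l - η) ^ 2) ^ |s| * ‖g (l - η)‖ ≤ K * (1 + (l - η) ^ 2)⁻¹ := by
    rw [← div_eq_mul_inv, le_div_iff₀ hu]
    linarith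
  calc (1 + l ^ 2) ^ s * ‖g (l - η)‖
      ≤ 2 ^ |s| * (1 + η ^ 2) ^ s * (1 + (l - η) ^ 2) ^ |s| * ‖g (l - η)‖ := by
        gcongr
        exact one_add_sq_rpow_le s l η
    _ = 2 ^ |s| * (1 + η ^ 2) ^ s * ((1 + (l - η) ^ 2) ^ |s| * ‖g (l - η)‖) := by ring
    _ ≤ 2 ^ |s| * (1 + η ^ 2) ^ s * (K * (1 + (l - η) ^ 2)⁻¹) := by gcongr
    _ = _ := by ring

lemma integrable_of_norm_le_inv_one_add_sq {f : ℝ → ℂ} (hf : Continuous f) {A η : ℝ}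
    (h : ∀ l, ‖f l‖ ≤ A * (1 + (l - η) ^ 2)⁻¹) : Integrable f :=
  ((integrable_inv_one_add_sq.comp_sub_right η).const_mul A).mono' hf.aestronglyMeasurable
    (Filter.Eventually.of_forall h)

lemma norm_integral_le_of_norm_le_inv_one_add_sq {f : ℝ → ℂ} {A η : ℝ}
    (h : ∀ l, ‖f l‖ ≤ A * (1 + (l - η) ^ 2)⁻¹) : ‖∫ l, f l‖ ≤ A * Real.pi := by
  refine (norm_integral_le_of_norm_le
    ((integrable_inv_one_add_sq.comp_sub_right η).const_mul A)
    (Filter.Eventually.of_forall h)).trans_eq ?_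
  rw [integral_const_mul, integral_sub_right_eq_self (fun l : ℝ => (1 + l ^ 2)⁻¹) η,
    integral_univ_inv_one_add_sq]

lemma norm_exp_I_mul_mul (x l : ℝ) : ‖Complex.exp (Complex.I * (x * l))‖ = 1 := by
  rw [← Complex.ofReal_mul, mul_comm, Complex.norm_exp_ofReal_mul_I]

lemma continuous_one_add_sq_rpow (s : ℝ) : Continuous fun l : ℝ => (1 + l ^ 2) ^ s :=
  Continuous.rpow_const (by fun_prop) fun l => Or.inl (by positivity)

/-- Pointwise decay of the Fourier integral of a Bessel weight times a translated Schwartz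
function, uniform in the translation up to the value of the weight there. -/
lemma SchwartzMap.exists_norm_sq_integral_weight_le (g : 𝓢(ℝ, ℂ)) (s : ℝ) :
    ∃ C : ℝ, 0 < C ∧ ∀ η x : ℝ,
      ‖∫ l : ℝ, (((1 + l ^ 2) ^ s : ℝ) : ℂ) * Complex.exp (Complex.I * (x * l)) *
        g (l - η)‖ ^ 2 ≤ C * (1 + η ^ 2) ^ (2 * s) * (1 + x ^ 2)⁻¹ := by
  obtain ⟨M, hM, hg⟩ := g.exists_weight_mul_norm_sub_le s
  obtain ⟨M', hM', hg'⟩ := (SchwartzMap.derivCLM ℝ ℂ g).exists_weight_mul_norm_sub_le s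
  refine ⟨(M * Real.pi) ^ 2 + ((|s| * M + M') * Real.pi) ^ 2 + 1, by positivity,
    fun η x => ?_⟩
  set W : ℝ := (1 + η ^ 2) ^ s with hW
  have hW0 : 0 < W := Real.rpow_pos_of_pos (by positivity) s
  let u : ℝ → ℂ := fun l => (((1 + l ^ 2) ^ s : ℝ) : ℂ) * g (l - η)
  let u' : ℝ → ℂ := fun l => ((2 * l * s * (1 + l ^ 2) ^ (s - 1) : ℝ) : ℂ) * g (l - η) +
    (((1 + l ^ 2) ^ s : ℝ) : ℂ) * SchwartzMap.derivCLM ℝ ℂ g (l - η)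
  let v : ℝ → ℂ := fun l => Complex.exp (Complex.I * (x * l))
  let v' : ℝ → ℂ := fun l => Complex.exp (Complex.I * (x * l)) * (Complex.I * x)
  have hu (l : ℝ) : HasDerivAt u (u' l) l := by
    refine (hasDerivAt_one_add_sq_rpow s l).ofReal_comp.mul ?_
    rw [SchwartzMap.derivCLM_apply]
    exact (g.differentiableAt (x := l - η)).hasDerivAt.comp_sub_const l η
  have hv (l : ℝ) : HasDerivAt v (v' l) l := by
    have h : HasDerivAt (fun l : ℝ => Complex.I * (x * (l : ℂ))) (Complex.I * x) l := by
      simpa using (((hasDerivAt_id l).ofReal_comp.const_mul (x : ℂ)).const_mul Complex.I)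
    exact h.cexp
  have hgc : Continuous fun l => g (l - η) := g.continuous.comp (by fun_prop)
  have hgc' : Continuous fun l => SchwartzMap.derivCLM ℝ ℂ g (l - η) :=
    (SchwartzMap.derivCLM ℝ ℂ g).continuous.comp (by fun_prop)
  have hw := Complex.continuous_ofReal.comp (continuous_one_add_sq_rpow s)
  have huc : Continuous u := hw.mul hgc
  have huc' : Continuous u' := by
    refine ((Complex.continuous_ofReal.comp ?_).mul hgc).add (hw.mul hgc')
    exact (show Continuous fun l : ℝ => 2 * l * s by fun_prop).mul
      (continuous_one_add_sq_rpow (s - 1))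
  have hvc : Continuous v := by fun_prop
  have hub (l : ℝ) : ‖u l‖ ≤ M * W * (1 + (l - η) ^ 2)⁻¹ := by
    simp only [u, norm_mul, Complex.norm_real, Real.norm_eq_abs]
    rw [abs_of_pos (Real.rpow_pos_of_pos (by positivity) s)]
    exact hg η l
  have hub' (l : ℝ) : ‖u' l‖ ≤ (|s| * M + M') * W * (1 + (l - η) ^ 2)⁻¹ := by
    refine (norm_add_le _ _).trans ?_
    simp only [norm_mul _ (g _), norm_mul _ (SchwartzMap.derivCLM ℝ ℂ g _), Complex.norm_real,
      Real.norm_eq_abs]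
    rw [abs_of_pos (Real.rpow_pos_of_pos (show 0 < 1 + l ^ 2 by positivity) s)]
    have h1 := mul_le_mul_of_nonneg_right (abs_deriv_one_add_sq_rpow_le s l)
      (norm_nonneg (g (l - η)))
    have h2 := mul_le_mul_of_nonneg_left (hg η l) (abs_nonneg s)
    have h3 := hg' η l
    linarith
  have hn (l : ℝ) : ‖v l‖ = 1 := norm_exp_I_mul_mul x l
  have huvb (l : ℝ) : ‖(u * v) l‖ ≤ M * W * (1 + (l - η) ^ 2)⁻¹ := by
    rw [Pi.mul_apply, norm_mul, hn, mul_one]; exact hub l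
  have huvb' (l : ℝ) : ‖(u' * v) l‖ ≤ (|s| * M + M') * W * (1 + (l - η) ^ 2)⁻¹ := by
    rw [Pi.mul_apply, norm_mul, hn, mul_one]; exact hub' l
  have huv := integrable_of_norm_le_inv_one_add_sq (huc.mul hvc) huvb
  have huv' := integrable_of_norm_le_inv_one_add_sq (huc'.mul hvc) huvb'
  have hv'_eq : u * v' = fun l => (u * v) l * (Complex.I * x) := by
    funext l
    simp only [Pi.mul_apply, v, v']
    ring
  have hparts := integral_mul_deriv_eq_deriv_mul_of_integrable (fun l _ => hu l)
    (fun l _ => hv l) (by rw [hv'_eq]; exact huv.mul_const _) huv' huv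
  have hF : (∫ l : ℝ, (((1 + l ^ 2) ^ s : ℝ) : ℂ) * Complex.exp (Complex.I * (x * l)) *
      g (l - η)) = ∫ l, (u * v) l := by
    congr 1
    funext l
    simp only [Pi.mul_apply, u, v]
    ring
  rw [hF]
  have hparts' : (∫ l, (u * v) l) * (Complex.I * x) = -∫ l, (u' * v) l := by
    rw [← integral_mul_const, ← hv'_eq]
    exact hparts
  have b1 := norm_integral_le_of_norm_le_inv_one_add_sq huvb
  have b2 := norm_integral_le_of_norm_le_inv_one_add_sq huvb'
  have hnorm := congrArg norm hparts'
  rw [norm_neg, norm_mul, norm_mul, Complex.norm_I, one_mul, Complex.norm_real,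
    Real.norm_eq_abs] at hnorm
  rw [← hnorm] at b2
  have s1 := pow_le_pow_left₀ (norm_nonneg _) b1 2
  have s2 := pow_le_pow_left₀ (by positivity) b2 2
  rw [mul_pow _ |x|, sq_abs] at s2
  have hW2 : (1 + η ^ 2) ^ (2 * s) = W ^ 2 := by
    rw [hW, mul_comm, Real.rpow_mul (by positivity), Real.rpow_two]
  rw [hW2, ← div_eq_mul_inv, le_div_iff₀ (by positivity)]
  nlinarith [sq_nonneg W]

/-- The Fourier transform of a test function, as a Schwartz function. -/
lemma exists_schwartzMap_eq_fourierT {χ : ℝ → ℝ} (hχ1 : ContDiff ℝ (⊤ : ℕ∞) χ)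
    (hχ2 : HasCompactSupport χ) : ∃ g : 𝓢(ℝ, ℂ), ∀ l, g l = fourierT χ l := by
  have hc : HasCompactSupport fun y => (χ y : ℂ) := hχ2.comp_left (g := Complex.ofReal) rfl
  have hd : ContDiff ℝ (⊤ : ℕ∞) fun y => (χ y : ℂ) := Complex.ofRealCLM.contDiff.comp hχ1
  let a : ℝˣ := Units.mk0 (2 * Real.pi)⁻¹ (by positivity)
  refine ⟨SchwartzMap.compCLMOfContinuousLinearEquiv ℂ (ContinuousLinearEquiv.unitsEquivAut ℝ a)
    (𝓕 (hc.toSchwartzMap hd)), fun l => ?_⟩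
  rw [SchwartzMap.compCLMOfContinuousLinearEquiv_apply, Function.comp_apply,
    ContinuousLinearEquiv.unitsEquivAut_apply, SchwartzMap.fourier_coe, Real.fourier_eq',
    fourierT]
  congr 1
  funext y
  rw [smul_eq_mul, mul_comm]
  congr 2
  have hpi : (Real.pi : ℂ) ≠ 0 := by exact_mod_cast Real.pi_ne_zero
  simp [a]
  field_simp

/-- Let `χ : ℝ → ℝ` be smooth and compactly supported, `σ ∈ ℝ` and `p ≥ 1` an integer.  Then
there is `C = C(χ, σ, p) > 0` such that for all `η₁, …, η_p ∈ ℝ`: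
`∫_ℝ ∏_{i=1}^p |F_{η_i}(x)|² dx ≤ C ∏_{i=1}^p (1+η_i²)^{−σ}`. -/
theorem stmt8 (χ : ℝ → ℝ) (hχ1 : ContDiff ℝ (⊤ : ℕ∞) χ) (hχ2 : HasCompactSupport χ)
    (σ : ℝ) (p : ℕ) (hp : 1 ≤ p) :
    ∃ C : ℝ, 0 < C ∧ ∀ η : Fin p → ℝ,
      (∫ x : ℝ, ∏ i : Fin p, ‖besselF χ σ (η i) x‖ ^ 2) ≤
        C * ∏ i : Fin p, (1 + (η i) ^ 2) ^ (-σ) := by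
  obtain ⟨g, hg⟩ := exists_schwartzMap_eq_fourierT hχ1 hχ2
  obtain ⟨C, hC, h⟩ := g.exists_norm_sq_integral_weight_le (-(σ / 2))
  simp only [hg, show 2 * (-(σ / 2)) = -σ by ring] at h
  refine ⟨C ^ p * Real.pi, by positivity, fun η => ?_⟩
  have hP : 0 ≤ ∏ i : Fin p, (1 + (η i) ^ 2) ^ (-σ) :=
    Finset.prod_nonneg fun i _ => by positivity
  have hle (x : ℝ) : ∏ i : Fin p, ‖besselF χ σ (η i) x‖ ^ 2 ≤
      C ^ p * (∏ i : Fin p, (1 + (η i) ^ 2) ^ (-σ)) * (1 + x ^ 2)⁻¹ := by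
    calc ∏ i : Fin p, ‖besselF χ σ (η i) x‖ ^ 2
        ≤ ∏ i : Fin p, C * (1 + (η i) ^ 2) ^ (-σ) * (1 + x ^ 2)⁻¹ :=
          Finset.prod_le_prod (fun i _ => by positivity) fun i _ => h (η i) x
      _ = C ^ p * (∏ i : Fin p, (1 + (η i) ^ 2) ^ (-σ)) * ((1 + x ^ 2)⁻¹) ^ p := by
          simp [Finset.prod_mul_distrib]
      _ ≤ _ := by
          gcongr
          exact pow_le_of_le_one (by positivity)
            (inv_le_one_of_one_le₀ (by nlinarith [sq_nonneg x])) (by omega)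
  refine (integral_mono_of_nonneg (Filter.Eventually.of_forall fun x =>
    Finset.prod_nonneg fun i _ => by positivity)
    (integrable_inv_one_add_sq.const_mul _) (Filter.Eventually.of_forall hle)).trans_eq ?_
  rw [integral_const_mul, integral_univ_inv_one_add_sq]
  ring
end

section
/- Let n ≥ 1, let f : [0,1] × ℝ → ℝ be bounded and measurable with f(t,·) supported in [−2^n, 2^n] for every t ∈ [0,1], and let L > 2^n. Define u(t,x) := ∫_0^t ∫_ℝ G_{t−s}(x−y) f(s,y) dy ds. Then for every x ∈ {−L, L} and every t ∈ [0,1], the map t ↦ u(t,x) is differentiable, and for every β > 0 there exists a constant C_β > 0, depending only on β (in particular independent of n, L, f, t), such that for x ∈ {−L, L}: |u(t,x)| + L^{1/2} · |∂_t u(t,x)| ≤ C_β · L^{1/2} · (L − 2^n)^{−β} · sup_{s∈[0,1]} ‖f(s,·)‖_{L^∞(ℝ)}. -/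
open MeasureTheory

/-- The heat kernel `G_t(x) = (4πt)^{−1/2} e^{−x²/(4t)}` for `t > 0`, `G_t(x) = 0` for `t ≤ 0`. -/
noncomputable def heatK (t x : ℝ) : ℝ :=
  if 0 < t then (4 * Real.pi * t) ^ (-(1/2 : ℝ)) * Real.exp (-x ^ 2 / (4 * t)) else 0

/-- The space-time heat convolution `u(t, x) = ∫_0^t ∫_ℝ G_{t−s}(x−y) f(s,y) dy ds`. -/
noncomputable def heatConv (f : ℝ → ℝ → ℝ) (t x : ℝ) : ℝ :=
  ∫ s in (0:ℝ)..t, ∫ y : ℝ, heatK (t - s) (x - y) * f s y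

/-- The time derivative of the heat kernel away from `x = 0`. -/
noncomputable def heatKDeriv (t x : ℝ) : ℝ :=
  heatK t x * (x ^ 2 / (4 * t) - 1 / 2) / t

theorem heatK_of_nonpos {t : ℝ} (ht : t ≤ 0) (x : ℝ) : heatK t x = 0 :=
  if_neg ht.not_gt

theorem heatK_nonneg (t x : ℝ) : 0 ≤ heatK t x := by
  unfold heatK
  split_ifs with h
  · have := Real.pi_pos
    positivity
  · rfl

theorem heatKDeriv_of_nonpos {t : ℝ} (ht : t ≤ 0) (x : ℝ) : heatKDeriv t x = 0 := by
  simp [heatKDeriv, heatK_of_nonpos ht]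

theorem measurable_heatK : Measurable fun p : ℝ × ℝ => heatK p.1 p.2 := by
  unfold heatK
  refine Measurable.ite (measurableSet_lt measurable_const measurable_fst) ?_ measurable_const
  fun_prop

theorem measurable_heatKDeriv : Measurable fun p : ℝ × ℝ => heatKDeriv p.1 p.2 := by
  have := measurable_heatK
  unfold heatKDeriv
  fun_prop

theorem Real.exp_neg_le_rpow {p w : ℝ} (hp : 0 < p) (hw : 0 < w) :
    Real.exp (-w) ≤ p ^ p * w ^ (-p) := by
  have h1 : w / p ≤ Real.exp (w / p) := by linarith [Real.add_one_le_exp (w / p)]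
  have h2 : (w / p) ^ p ≤ Real.exp (w / p) ^ p :=
    Real.rpow_le_rpow (by positivity) h1 hp.le
  rw [← Real.exp_mul, div_mul_cancel₀ _ hp.ne', Real.div_rpow hw.le hp.le,
    div_le_iff₀ (by positivity)] at h2
  rw [Real.exp_neg, Real.rpow_neg hw.le, ← div_eq_mul_inv, inv_eq_one_div,
    div_le_div_iff₀ (Real.exp_pos _) (by positivity)]
  linarith

theorem heatK_le_of_exp {C p t x a : ℝ} (ht : 0 < t) (hx : x ≠ 0) (ha : 0 ≤ a)
    (h : a * Real.exp (-(x ^ 2 / (4 * t))) ≤ C * (x ^ 2 / (4 * t)) ^ (-p)) :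
    a * heatK t x ≤ C * 4 ^ p * (t ^ (p - 1 / 2) * |x| ^ (-(2 * p))) := by
  have hx' : 0 < |x| := abs_pos.mpr hx
  have hpi : (4 * Real.pi * t) ^ (-(1 / 2 : ℝ)) ≤ t ^ (-(1 / 2 : ℝ)) := by
    refine Real.rpow_le_rpow_of_nonpos ht ?_ (by norm_num)
    nlinarith [Real.pi_gt_three]
  have hw : (x ^ 2 / (4 * t)) ^ (-p) = 4 ^ p * (t ^ p * |x| ^ (-(2 * p))) := by
    rw [Real.rpow_neg (by positivity), Real.div_rpow (by positivity) (by positivity),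
      Real.mul_rpow (by norm_num) ht.le, ← sq_abs x, ← Real.rpow_natCast |x| 2,
      ← Real.rpow_mul hx'.le, Real.rpow_neg hx'.le]
    push_cast
    field_simp
  rw [heatK, if_pos ht, neg_div]
  calc a * ((4 * Real.pi * t) ^ (-(1 / 2 : ℝ)) * Real.exp (-(x ^ 2 / (4 * t))))
      = (4 * Real.pi * t) ^ (-(1 / 2 : ℝ)) * (a * Real.exp (-(x ^ 2 / (4 * t)))) := by ring
    _ ≤ t ^ (-(1 / 2 : ℝ)) * (C * (x ^ 2 / (4 * t)) ^ (-p)) := by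
      gcongr
    _ = C * 4 ^ p * (t ^ (p - 1 / 2) * |x| ^ (-(2 * p))) := by
      rw [hw, sub_eq_add_neg, Real.rpow_add ht]
      ring

theorem exists_heatK_le {p : ℝ} (hp : 0 < p) : ∃ C : ℝ, 0 < C ∧ ∀ t x : ℝ, 0 < t → x ≠ 0 →
    heatK t x ≤ C * (t ^ (p - 1 / 2) * |x| ^ (-(2 * p))) := by
  refine ⟨p ^ p * 4 ^ p, by positivity, fun t x ht hx => ?_⟩
  simpa using heatK_le_of_exp ht hx zero_le_one
    (by simpa using Real.exp_neg_le_rpow hp (w := x ^ 2 / (4 * t)) (by positivity))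

theorem exists_abs_heatKDeriv_le {p : ℝ} (hp : 0 < p) : ∃ C : ℝ, 0 < C ∧
    ∀ t x : ℝ, 0 < t → x ≠ 0 →
      |heatKDeriv t x| ≤ C * (t ^ (p - 3 / 2) * |x| ^ (-(2 * p))) := by
  refine ⟨((p + 1) ^ (p + 1) + p ^ p) * 4 ^ p, by positivity, fun t x ht hx => ?_⟩
  have key : (x ^ 2 / (4 * t) + 1) * heatK t x ≤
      ((p + 1) ^ (p + 1) + p ^ p) * 4 ^ p * (t ^ (p - 1 / 2) * |x| ^ (-(2 * p))) := by
    refine heatK_le_of_exp ht hx (by positivity) ?_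
    have hw : 0 < x ^ 2 / (4 * t) := by positivity
    set w := x ^ 2 / (4 * t)
    have h1 := Real.exp_neg_le_rpow hp hw
    have h2 := mul_le_mul_of_nonneg_left
      (Real.exp_neg_le_rpow (add_pos hp one_pos) hw) hw.le
    have h3 : w * w ^ (-(p + 1)) = w ^ (-p) := by
      rw [← Real.rpow_one_add' hw.le (by linarith)]
      congr 1
      ring
    rw [mul_left_comm, h3] at h2
    linarith
  have habs : |heatKDeriv t x| ≤ (x ^ 2 / (4 * t) + 1) * heatK t x / t := by
    rw [heatKDeriv, abs_div, abs_of_pos ht, abs_mul, abs_of_nonneg (heatK_nonneg t x), mul_comm]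
    have := heatK_nonneg t x
    have hw : 0 < x ^ 2 / (4 * t) := by positivity
    gcongr
    rw [abs_le]
    constructor <;> linarith
  refine habs.trans ?_
  rw [div_le_iff₀ ht]
  refine key.trans_eq ?_
  have h4 : t ^ (p - 1 / 2) = t ^ (p - 3 / 2) * t := by
    rw [← Real.rpow_add_one ht.ne']
    congr 1
    ring
  rw [h4]
  ring

theorem hasDerivAt_heatK (t : ℝ) {x : ℝ} (hx : x ≠ 0) :
    HasDerivAt (fun r => heatK r x) (heatKDeriv t x) t := by
  rcases lt_trichotomy t 0 with ht | rfl | ht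
  · rw [heatKDeriv_of_nonpos ht.le]
    refine (hasDerivAt_const t (0 : ℝ)).congr_of_eventuallyEq ?_
    filter_upwards [Iio_mem_nhds ht] with r hr using heatK_of_nonpos (le_of_lt hr) x
  · rw [heatKDeriv_of_nonpos le_rfl]
    obtain ⟨C, hC, h⟩ := exists_heatK_le (p := 5 / 2) (by norm_num)
    have hO : (fun r => heatK r x) =O[nhds 0] fun r => ‖r - 0‖ ^ 2 := by
      refine Asymptotics.IsBigO.of_bound (C * |x| ^ (-(2 * (5 / 2 : ℝ)))) (.of_forall fun r => ?_)
      rw [Real.norm_of_nonneg (heatK_nonneg r x)]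
      rcases le_or_gt r 0 with hr | hr
      · rw [heatK_of_nonpos hr]
        positivity
      · refine (h r x hr hx).trans_eq ?_
        norm_num
        ring
    have := (hO.hasFDerivAt one_lt_two).hasDerivAt
    simpa using this
  · have hpos : 0 < 4 * Real.pi * t := by
      have := Real.pi_pos
      positivity
    have h1 : HasDerivAt (fun r : ℝ => (4 * Real.pi * r) ^ (-(1 / 2 : ℝ)))
        (4 * Real.pi * (-(1 / 2)) * (4 * Real.pi * t) ^ (-(1 / 2 : ℝ) - 1)) t := by
      have h := ((hasDerivAt_id t).const_mul (4 * Real.pi)).rpow_const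
        (p := -(1 / 2 : ℝ)) (Or.inl (by simpa using hpos.ne'))
      simpa using h
    have h2 : HasDerivAt (fun r : ℝ => Real.exp (-x ^ 2 / (4 * r)))
        (Real.exp (-x ^ 2 / (4 * t)) * (x ^ 2 / (4 * t ^ 2))) t := by
      have h := (((hasDerivAt_id t).const_mul (4 : ℝ)).inv (by simpa using ht.ne')).const_mul
        (-x ^ 2)
      refine HasDerivAt.exp (f := fun r : ℝ => -x ^ 2 / (4 * r)) ?_
      refine HasDerivAt.congr_deriv h ?_
      simp only [id]
      field_simp
    have h3 := (h1.mul h2).congr_of_eventuallyEq (f₁ := fun r => heatK r x) (by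
      filter_upwards [Ioi_mem_nhds ht] with r hr
      simp [heatK, Set.mem_Ioi.mp hr])
    refine h3.congr_deriv ?_
    rw [heatKDeriv, heatK, if_pos ht, Real.rpow_sub_one hpos.ne']
    field_simp
    ring

/-- The product of Lebesgue measures on `(0, 1]` and `[-M, M]`. -/
noncomputable def spaceTimeMeasure (M : ℝ) : Measure (ℝ × ℝ) :=
  (volume.restrict (Set.Ioc 0 1)).prod (volume.restrict (Set.Icc (-M) M))

instance (M : ℝ) : IsFiniteMeasure (spaceTimeMeasure M) := by
  unfold spaceTimeMeasure
  infer_instance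

theorem ae_spaceTimeMeasure (M : ℝ) :
    ∀ᵐ p ∂spaceTimeMeasure M, p.1 ∈ Set.Ioc (0 : ℝ) 1 ∧ p.2 ∈ Set.Icc (-M) M := by
  rw [spaceTimeMeasure, Measure.prod_restrict]
  exact ae_restrict_mem (measurableSet_Ioc.prod measurableSet_Icc)

theorem le_abs_sub_of_mem_Icc {L M x y : ℝ} (hML : M < L) (hx : x = -L ∨ x = L)
    (hy : y ∈ Set.Icc (-M) M) : L - M ≤ |x - y| := by
  rcases hx with rfl | rfl
  · exact le_abs.mpr (Or.inr (by linarith [hy.1]))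
  · exact le_abs.mpr (Or.inl (by linarith [hy.2]))

theorem setIntegral_abs_sub_rpow_le {β L M x : ℝ} (hβ : 0 < β) (hM : 0 ≤ M) (hML : M < L)
    (hx : x = -L ∨ x = L) :
    IntegrableOn (fun y => |x - y| ^ (-(1 + β))) (Set.Icc (-M) M) ∧
      ∫ y in Set.Icc (-M) M, |x - y| ^ (-(1 + β)) ≤ (L - M) ^ (-β) / β := by
  refine ⟨ContinuousOn.integrableOn_compact isCompact_Icc ?_, ?_⟩
  · refine ContinuousOn.rpow_const (by fun_prop) fun y hy => Or.inl ?_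
    have := le_abs_sub_of_mem_Icc hML hx hy
    linarith
  · have hcomp : ∫ y in Set.Icc (-M) M, |x - y| ^ (-(1 + β)) =
        ∫ w in (L - M)..(L + M), w ^ (-(1 + β)) := by
      rw [integral_Icc_eq_integral_Ioc, ← intervalIntegral.integral_of_le (by linarith)]
      rcases hx with rfl | rfl
      · have h := intervalIntegral.integral_comp_add_left (a := -M) (b := M)
          (fun w : ℝ => w ^ (-(1 + β))) L
        rw [← sub_eq_add_neg] at h
        rw [← h]
        refine intervalIntegral.integral_congr fun y hy => ?_
        rw [Set.uIcc_of_le (by linarith)] at hy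
        have : |-L - y| = L + y := by
          rw [abs_of_neg (by linarith [hy.1])]
          ring
        simp only [this]
      · have h := intervalIntegral.integral_comp_sub_left (a := -M) (b := M)
          (fun w : ℝ => w ^ (-(1 + β))) x
        rw [sub_neg_eq_add] at h
        rw [← h]
        refine intervalIntegral.integral_congr fun y hy => ?_
        rw [Set.uIcc_of_le (by linarith)] at hy
        simp only [abs_of_pos (show 0 < x - y by linarith [hy.2])]
    rw [hcomp, integral_rpow (Or.inr ⟨by linarith, by
      rw [Set.uIcc_of_le (by linarith)]
      exact fun h => by linarith [h.1]⟩)]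
    rw [show -(1 + β) + 1 = -β by ring, div_neg, ← neg_div, neg_sub]
    gcongr
    linarith [Real.rpow_nonneg (show 0 ≤ L + M by linarith) (-β)]

theorem integral_indicator_sub_rpow_le {γ t : ℝ} (hγ : 0 < γ) (ht : t ∈ Set.Icc (0 : ℝ) 1) :
    Integrable ((Set.Ioc 0 t).indicator fun s => (t - s) ^ (γ - 1)) ∧
      ∫ s, (Set.Ioc 0 t).indicator (fun s => (t - s) ^ (γ - 1)) s ≤ 1 / γ := by
  have hint : IntervalIntegrable (fun s => (t - s) ^ (γ - 1)) volume 0 t := by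
    have h := (intervalIntegral.intervalIntegrable_rpow' (a := t) (b := 0)
      (r := γ - 1) (by linarith)).comp_sub_left t
    simpa using h
  rw [intervalIntegrable_iff_integrableOn_Ioc_of_le ht.1] at hint
  refine ⟨hint.integrable_indicator measurableSet_Ioc, ?_⟩
  rw [integral_indicator measurableSet_Ioc, ← intervalIntegral.integral_of_le ht.1,
    intervalIntegral.integral_comp_sub_left (fun w : ℝ => w ^ (γ - 1)),
    integral_rpow (Or.inl (by linarith))]
  simp only [sub_self, sub_zero, sub_add_cancel, Real.zero_rpow hγ.ne']
  gcongr
  exact Real.rpow_le_one ht.1 ht.2 hγ.le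

theorem abs_integral_kernel_mul_le {β K A L M t x : ℝ} {k f : ℝ → ℝ → ℝ} (hβ : 0 < β)
    (hK : 0 ≤ K) (hA : 0 ≤ A) (hM : 0 ≤ M) (hML : M < L) (hx : x = -L ∨ x = L)
    (ht : t ∈ Set.Icc (0 : ℝ) 1) (hk_zero : ∀ r z, r ≤ 0 → k r z = 0)
    (hk : ∀ r z, 0 < r → r ≤ 1 → z ≠ 0 → |k r z| ≤ K * (r ^ (β / 2 - 1) * |z| ^ (-(1 + β))))
    (hf : ∀ s ∈ Set.Icc (0 : ℝ) 1, ∀ y, |f s y| ≤ A) :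
    |∫ p, k (t - p.1) (x - p.2) * f p.1 p.2 ∂spaceTimeMeasure M| ≤
      K * (2 / β ^ 2) * (L - M) ^ (-β) * A := by
  obtain ⟨hφ, hφ_le⟩ := integral_indicator_sub_rpow_le (half_pos hβ) ht
  obtain ⟨hψ, hψ_le⟩ := setIntegral_abs_sub_rpow_le hβ hM hML hx
  set φ : ℝ → ℝ := (Set.Ioc 0 t).indicator fun s => (t - s) ^ (β / 2 - 1) with hφ_def
  have hφ_nonneg : ∀ s, 0 ≤ φ s := fun s =>
    Set.indicator_nonneg (fun s hs => Real.rpow_nonneg (sub_nonneg.mpr hs.2) _) s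
  have hbound : ∀ᵐ p ∂spaceTimeMeasure M, ‖k (t - p.1) (x - p.2) * f p.1 p.2‖ ≤
      K * A * (φ p.1 * |x - p.2| ^ (-(1 + β))) := by
    filter_upwards [ae_spaceTimeMeasure M] with p hp
    have hz : x - p.2 ≠ 0 := by
      have := le_abs_sub_of_mem_Icc hML hx hp.2
      exact abs_pos.mp (by linarith)
    have hφp := hφ_nonneg p.1
    rcases le_or_gt (t - p.1) 0 with h | h
    · rw [hk_zero _ _ h, zero_mul, norm_zero]
      positivity
    · rw [norm_mul, Real.norm_eq_abs, Real.norm_eq_abs, hφ_def,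
        Set.indicator_of_mem (show p.1 ∈ Set.Ioc 0 t from ⟨hp.1.1, by linarith⟩)]
      calc _ ≤ K * ((t - p.1) ^ (β / 2 - 1) * |x - p.2| ^ (-(1 + β))) * A :=
            mul_le_mul (hk _ _ h (by linarith [hp.1.1, ht.2]) hz)
              (hf _ ⟨hp.1.1.le, hp.1.2⟩ _) (abs_nonneg _) (by positivity)
        _ = _ := by ring
  have hint : Integrable (fun p : ℝ × ℝ => K * A * (φ p.1 * |x - p.2| ^ (-(1 + β))))
      (spaceTimeMeasure M) :=
    (hφ.restrict.mul_prod hψ).const_mul _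
  have h := norm_integral_le_of_norm_le hint hbound
  rw [integral_const_mul, spaceTimeMeasure,
    integral_prod_mul φ fun y => |x - y| ^ (-(1 + β))] at h
  have hφ_set : ∫ s in Set.Ioc 0 1, φ s ≤ 1 / (β / 2) :=
    (setIntegral_le_integral hφ (.of_forall hφ_nonneg)).trans hφ_le
  have hψ_nonneg : 0 ≤ ∫ y in Set.Icc (-M) M, |x - y| ^ (-(1 + β)) :=
    integral_nonneg fun y => by positivity
  calc _ ≤ _ := h
    _ ≤ K * A * (1 / (β / 2) * ((L - M) ^ (-β) / β)) := by gcongr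
    _ = _ := by
      field_simp

section

variable {A L M x : ℝ} {f : ℝ → ℝ → ℝ}

theorem exists_kernel_bound (hML : M < L) (hx : x = -L ∨ x = L) : ∃ B : ℝ, 0 ≤ B ∧
    ∀ y ∈ Set.Icc (-M) M, ∀ r : ℝ, |heatK r (x - y)| ≤ B ∧ |heatKDeriv r (x - y)| ≤ B := by
  obtain ⟨C, hC, h⟩ := exists_heatK_le (p := 1 / 2) (by norm_num)
  obtain ⟨D, hD, h'⟩ := exists_abs_heatKDeriv_le (p := 3 / 2) (by norm_num)
  have hd : 0 < L - M := sub_pos.mpr hML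
  refine ⟨C * (L - M) ^ (-(1 : ℝ)) + D * (L - M) ^ (-(3 : ℝ)), by positivity,
    fun y hy r => ?_⟩
  have hz := le_abs_sub_of_mem_Icc hML hx hy
  have hz' : x - y ≠ 0 := abs_pos.mp (hd.trans_le hz)
  have hC' : 0 ≤ C * (L - M) ^ (-(1 : ℝ)) := by positivity
  have hD' : 0 ≤ D * (L - M) ^ (-(3 : ℝ)) := by positivity
  rcases le_or_gt r 0 with hr | hr
  · rw [heatK_of_nonpos hr, heatKDeriv_of_nonpos hr, abs_zero]
    exact ⟨by positivity, by positivity⟩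
  · have h1 := h r _ hr hz'
    have h2 := h' r _ hr hz'
    rw [sub_self, Real.rpow_zero, one_mul, show -(2 * (1 / 2 : ℝ)) = -1 by norm_num] at h1
    rw [sub_self, Real.rpow_zero, one_mul, show -(2 * (3 / 2 : ℝ)) = -3 by norm_num] at h2
    have h3 : |x - y| ^ (-(1 : ℝ)) ≤ (L - M) ^ (-(1 : ℝ)) :=
      Real.rpow_le_rpow_of_nonpos hd hz (by norm_num)
    have h4 : |x - y| ^ (-(3 : ℝ)) ≤ (L - M) ^ (-(3 : ℝ)) :=
      Real.rpow_le_rpow_of_nonpos hd hz (by norm_num)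
    rw [abs_of_nonneg (heatK_nonneg _ _)]
    have h5 := mul_le_mul_of_nonneg_left h3 hC.le
    have h6 := mul_le_mul_of_nonneg_left h4 hD.le
    constructor <;> linarith

theorem measurable_kernel_mul {k : ℝ → ℝ → ℝ} (hk : Measurable fun p : ℝ × ℝ => k p.1 p.2)
    (hf : Measurable (Function.uncurry f)) (t x : ℝ) :
    Measurable fun p : ℝ × ℝ => k (t - p.1) (x - p.2) * f p.1 p.2 :=
  (hk.comp (f := fun p : ℝ × ℝ => (t - p.1, x - p.2)) (by fun_prop)).mul hf

theorem integrable_heatK_mul (hML : M < L) (hx : x = -L ∨ x = L)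
    (hf : Measurable (Function.uncurry f)) (hA : ∀ s ∈ Set.Icc (0 : ℝ) 1, ∀ y, |f s y| ≤ A)
    (t : ℝ) :
    Integrable (fun p => heatK (t - p.1) (x - p.2) * f p.1 p.2) (spaceTimeMeasure M) := by
  obtain ⟨B, hB, h⟩ := exists_kernel_bound hML hx
  refine Integrable.of_bound
    (measurable_kernel_mul measurable_heatK hf t x).aestronglyMeasurable (B * A) ?_
  filter_upwards [ae_spaceTimeMeasure M] with p hp
  rw [norm_mul]
  exact mul_le_mul (h _ hp.2 _).1 (hA _ ⟨hp.1.1.le, hp.1.2⟩ _) (norm_nonneg _) hB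

theorem heatConv_eq_integral_spaceTimeMeasure (hML : M < L) (hx : x = -L ∨ x = L)
    (hf : Measurable (Function.uncurry f)) (hA : ∀ s ∈ Set.Icc (0 : ℝ) 1, ∀ y, |f s y| ≤ A)
    (hsupp : ∀ s ∈ Set.Icc (0 : ℝ) 1, ∀ y, y ∉ Set.Icc (-M) M → f s y = 0)
    {t : ℝ} (ht : t ∈ Set.Icc (0 : ℝ) 1) :
    heatConv f t x = ∫ p, heatK (t - p.1) (x - p.2) * f p.1 p.2 ∂spaceTimeMeasure M := by
  have hint := integrable_heatK_mul hML hx hf hA t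
  rw [spaceTimeMeasure] at hint ⊢
  rw [integral_prod _ hint, heatConv, intervalIntegral.integral_of_le ht.1]
  have hinner : ∀ s ∈ Set.Ioc (0 : ℝ) 1, ∫ y, heatK (t - s) (x - y) * f s y =
      ∫ y in Set.Icc (-M) M, heatK (t - s) (x - y) * f s y := fun s hs =>
    (setIntegral_eq_integral_of_forall_compl_eq_zero fun y hy => by
      rw [hsupp s ⟨hs.1.le, hs.2⟩ y hy, mul_zero]).symm
  rw [← setIntegral_congr_fun measurableSet_Ioc hinner]
  refine (setIntegral_eq_of_subset_of_forall_sdiff_eq_zero measurableSet_Ioc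
    (Set.Ioc_subset_Ioc_right ht.2) fun s hs => ?_).symm
  have hs' : t - s ≤ 0 := by
    by_contra! h
    exact hs.2 ⟨hs.1.1, by linarith⟩
  simp [heatK_of_nonpos hs']

theorem hasDerivAt_integral_heatK_mul (hML : M < L) (hx : x = -L ∨ x = L)
    (hf : Measurable (Function.uncurry f)) (hA : ∀ s ∈ Set.Icc (0 : ℝ) 1, ∀ y, |f s y| ≤ A)
    (t : ℝ) :
    HasDerivAt (fun τ => ∫ p, heatK (τ - p.1) (x - p.2) * f p.1 p.2 ∂spaceTimeMeasure M)
      (∫ p, heatKDeriv (t - p.1) (x - p.2) * f p.1 p.2 ∂spaceTimeMeasure M) t := by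
  obtain ⟨B, hB, h⟩ := exists_kernel_bound hML hx
  refine (hasDerivAt_integral_of_dominated_loc_of_deriv_le (bound := fun _ => B * A)
    (F' := fun τ p => heatKDeriv (τ - p.1) (x - p.2) * f p.1 p.2)
    Filter.univ_mem
    (.of_forall fun τ => (measurable_kernel_mul measurable_heatK hf τ x).aestronglyMeasurable)
    (integrable_heatK_mul hML hx hf hA t)
    (measurable_kernel_mul measurable_heatKDeriv hf t x).aestronglyMeasurable
    ?_ (integrable_const _) ?_).2
  · filter_upwards [ae_spaceTimeMeasure M] with p hp τ _
    rw [norm_mul]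
    exact mul_le_mul (h _ hp.2 _).2 (hA _ ⟨hp.1.1.le, hp.1.2⟩ _) (norm_nonneg _) hB
  · filter_upwards [ae_spaceTimeMeasure M] with p hp τ _
    have hz : x - p.2 ≠ 0 := by
      have := le_abs_sub_of_mem_Icc hML hx hp.2
      exact abs_pos.mp (by linarith)
    exact ((hasDerivAt_heatK (τ - p.1) hz).comp_sub_const τ p.1).mul_const _

end

/-- Smallness of the heat convolution `u = G ∗ f` and of its time derivative at the boundary
points `±L` of the computational domain, when the bounded measurable source `f(t,·)` is
supported in `[−2^n, 2^n]` with `2^n < L`: `t ↦ u(t,x)` is differentiable on `[0,1]` for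
`x ∈ {−L, L}`, and for every `β > 0` there is `C_β > 0` (independent of `n`, `L`, `f`, `t`)
such that `|u(t,x)| + L^{1/2} |∂_t u(t,x)| ≤ C_β L^{1/2} (L − 2^n)^{−β} sup_s ‖f(s,·)‖_∞`. -/
theorem stmt16 (β : ℝ) (hβ : 0 < β) :
    ∃ C : ℝ, 0 < C ∧
      ∀ (n : ℕ), 1 ≤ n → ∀ (f : ℝ → ℝ → ℝ),
        Measurable (Function.uncurry f) →
        (∀ t ∈ Set.Icc (0:ℝ) 1, ∀ y : ℝ, y ∉ Set.Icc (-(2:ℝ) ^ n) ((2:ℝ) ^ n) → f t y = 0) →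
      ∀ (L : ℝ), (2:ℝ) ^ n < L →
      ∀ (A : ℝ), (∀ s ∈ Set.Icc (0:ℝ) 1, ∀ y : ℝ, |f s y| ≤ A) →
      ∀ t ∈ Set.Icc (0:ℝ) 1, ∀ x : ℝ, x = -L ∨ x = L →
        DifferentiableWithinAt ℝ (fun τ => heatConv f τ x) (Set.Icc (0:ℝ) 1) t ∧
        |heatConv f t x| +
            Real.sqrt L * |derivWithin (fun τ => heatConv f τ x) (Set.Icc (0:ℝ) 1) t| ≤
          C * Real.sqrt L * (L - 2 ^ n) ^ (-β) * A := by
  obtain ⟨C₁, hC₁, hK⟩ := exists_heatK_le (p := (1 + β) / 2) (by linarith)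
  obtain ⟨C₂, hC₂, hK'⟩ := exists_abs_heatKDeriv_le (p := (1 + β) / 2) (by linarith)
  have hexp : -(2 * ((1 + β) / 2)) = -(1 + β) := by ring
  refine ⟨(C₁ + C₂) * (2 / β ^ 2), by positivity, ?_⟩
  intro n hn f hf hsupp L hL A hA t ht x hx
  have hM : (1 : ℝ) ≤ 2 ^ n := one_le_pow₀ one_le_two
  have hA0 : 0 ≤ A := (abs_nonneg _).trans (hA 0 (by simp) 0)
  have hu : ∀ τ ∈ Set.Icc (0 : ℝ) 1, heatConv f τ x =
      ∫ p, heatK (τ - p.1) (x - p.2) * f p.1 p.2 ∂spaceTimeMeasure (2 ^ n) := fun τ hτ =>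
    heatConv_eq_integral_spaceTimeMeasure hL hx hf hA hsupp hτ
  have hderiv : HasDerivWithinAt (fun τ => heatConv f τ x)
      (∫ p, heatKDeriv (t - p.1) (x - p.2) * f p.1 p.2 ∂spaceTimeMeasure (2 ^ n))
      (Set.Icc 0 1) t :=
    (hasDerivAt_integral_heatK_mul hL hx hf hA t).hasDerivWithinAt.congr hu (hu t ht)
  refine ⟨hderiv.differentiableWithinAt, ?_⟩
  rw [hderiv.derivWithin (uniqueDiffOn_Icc one_pos t ht), hu t ht]
  have hM0 : (0 : ℝ) ≤ 2 ^ n := zero_le_one.trans hM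
  have hbound := abs_integral_kernel_mul_le hβ hC₁.le hA0 hM0 hL hx ht
    (fun r z hr => heatK_of_nonpos hr z) (fun r z hr hr1 hz => by
      rw [abs_of_nonneg (heatK_nonneg r z)]
      refine (hK r z hr hz).trans ?_
      rw [hexp]
      have : r ^ ((1 + β) / 2 - 1 / 2) ≤ r ^ (β / 2 - 1) :=
        Real.rpow_le_rpow_of_exponent_ge hr hr1 (by linarith)
      gcongr) hA
  have hbound' := abs_integral_kernel_mul_le hβ hC₂.le hA0 hM0 hL hx ht
    (fun r z hr => heatKDeriv_of_nonpos hr z) (fun r z hr hr1 hz => by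
      refine (hK' r z hr hz).trans_eq ?_
      rw [hexp, show (1 + β) / 2 - 3 / 2 = β / 2 - 1 by ring]) hA
  have hsqrt : 1 ≤ Real.sqrt L := Real.one_le_sqrt.mpr (by linarith)
  have hd : 0 ≤ L - 2 ^ n := by linarith
  calc _ ≤ C₁ * (2 / β ^ 2) * (L - 2 ^ n) ^ (-β) * A +
        Real.sqrt L * (C₂ * (2 / β ^ 2) * (L - 2 ^ n) ^ (-β) * A) := by gcongr
    _ ≤ Real.sqrt L * (C₁ * (2 / β ^ 2) * (L - 2 ^ n) ^ (-β) * A) +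
        Real.sqrt L * (C₂ * (2 / β ^ 2) * (L - 2 ^ n) ^ (-β) * A) := by
      refine add_le_add_left (le_mul_of_one_le_left ?_ hsqrt) _
      positivity
    _ = _ := by ring
end
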